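/- There exists a constant C > 0 such that for every n ≥ 2, the total variation distance between consecutive Gibbs measures satisfies d_TV(ν_{a_n}, ν_{a_{n+1}}) ≤ C / (n log n). -/

import Mathlib

open MeasureTheory Filter

/-- Total variation distance between two measures. -/
noncomputable def dTV {E : Type*} [MeasurableSpace E] (μ ν : Measure E) : ℝ :=
  2 * ⨆ B : {B : Set E // MeasurableSet B}, |(μ B).toReal - (ν B).toReal|

/-- The Gibbs measure `ν_a(dx) ∝ e^{−2(V(x)−V*)/a²} dx` on `ℝ^d`. -/
noncomputable def gibbs {d : ℕ} (V : EuclideanSpace ℝ (Fin d) → ℝ) (Vstar a : ℝ) :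
    Measure (EuclideanSpace ℝ (Fin d)) :=
  (∫⁻ x, ENNReal.ofReal (Real.exp (-2 * (V x - Vstar) / a ^ 2)))⁻¹ •
    volume.withDensity fun x => ENNReal.ofReal (Real.exp (-2 * (V x - Vstar) / a ^ 2))

open Metric

section TotalVariation

variable {E : Type*} [MeasurableSpace E]

/-- If `μ` dominates `c • ν`, then the total variation distance of `μ` and `ν` is at most
`2 * (1 - c)`. -/
lemma dTV_le_of_mul_le {μ ν : Measure E} [IsProbabilityMeasure μ] [IsProbabilityMeasure ν] {c : ℝ}
    (h : ∀ B, MeasurableSet B → c * ν.real B ≤ μ.real B) : dTV μ ν ≤ 2 * (1 - c) := by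
  have hc : c ≤ 1 := by simpa using h _ MeasurableSet.univ
  have key : ∀ B, MeasurableSet B → ν.real B - μ.real B ≤ 1 - c := fun B hB => by
    have h1 := h B hB
    have h2 : ν.real B ≤ 1 := measureReal_le_one
    nlinarith
  have hsup : ⨆ B : {B : Set E // MeasurableSet B}, |(μ B).toReal - (ν B).toReal| ≤ 1 - c := by
    have : Nonempty {B : Set E // MeasurableSet B} := ⟨⟨∅, MeasurableSet.empty⟩⟩
    refine ciSup_le fun ⟨B, hB⟩ => ?_
    change |μ.real B - ν.real B| ≤ 1 - c
    rw [abs_le]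
    have h1 := key B hB
    have h2 := key Bᶜ hB.compl
    rw [probReal_compl_eq_one_sub hB, probReal_compl_eq_one_sub hB] at h2
    constructor <;> linarith
  unfold dTV
  linarith

end TotalVariation

section Gibbs

variable {d : ℕ} {V : EuclideanSpace ℝ (Fin d) → ℝ} {Vstar a b : ℝ}

lemma gibbs_real_apply
    (hint : Integrable fun x => Real.exp (-2 * (V x - Vstar) / a ^ 2))
    {B : Set (EuclideanSpace ℝ (Fin d))} (hB : MeasurableSet B) :
    (gibbs V Vstar a).real B = (∫ x in B, Real.exp (-2 * (V x - Vstar) / a ^ 2)) /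
      ∫ x, Real.exp (-2 * (V x - Vstar) / a ^ 2) := by
  rw [gibbs, measureReal_def, Measure.smul_apply, withDensity_apply _ hB, smul_eq_mul,
    ENNReal.toReal_mul, ENNReal.toReal_inv,
    integral_eq_lintegral_of_nonneg_ae (ae_of_all _ fun x => (Real.exp_pos _).le)
      hint.aestronglyMeasurable,
    integral_eq_lintegral_of_nonneg_ae (ae_of_all _ fun x => (Real.exp_pos _).le)
      hint.aestronglyMeasurable.restrict, div_eq_inv_mul]

lemma isProbabilityMeasure_gibbs
    (hint : Integrable fun x => Real.exp (-2 * (V x - Vstar) / a ^ 2)) :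
    IsProbabilityMeasure (gibbs V Vstar a) := by
  have h := gibbs_real_apply hint MeasurableSet.univ
  rw [Measure.restrict_univ, div_self (integral_exp_pos hint).ne', measureReal_def] at h
  refine ⟨?_⟩
  rwa [ENNReal.toReal_eq_one_iff] at h

lemma dTV_gibbs_le
    (hinta : Integrable fun x => Real.exp (-2 * (V x - Vstar) / a ^ 2))
    (hintb : Integrable fun x => Real.exp (-2 * (V x - Vstar) / b ^ 2))
    (hab : ∀ x, -2 * (V x - Vstar) / b ^ 2 ≤ -2 * (V x - Vstar) / a ^ 2) :
    dTV (gibbs V Vstar a) (gibbs V Vstar b) ≤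
      2 * (1 - (∫ x, Real.exp (-2 * (V x - Vstar) / b ^ 2)) /
        ∫ x, Real.exp (-2 * (V x - Vstar) / a ^ 2)) := by
  have := isProbabilityMeasure_gibbs hinta
  have := isProbabilityMeasure_gibbs hintb
  refine dTV_le_of_mul_le fun B hB => ?_
  have ha := integral_exp_pos hinta
  have hb := integral_exp_pos hintb
  rw [gibbs_real_apply hinta hB, gibbs_real_apply hintb hB, mul_comm, div_mul_div_cancel₀ hb.ne']
  refine div_le_div_of_nonneg_right ?_ ha.le
  exact setIntegral_mono hintb.integrableOn hinta.integrableOn fun x => Real.exp_le_exp.2 (hab x)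

end Gibbs

section Taylor

variable {E : Type*} [NormedAddCommGroup E] [NormedSpace ℝ E]

/-- Second-order Taylor estimate at a critical point. -/
lemma exists_abs_sub_half_hessian_le {f : E → ℝ} {x₀ : E} (hf : ContDiff ℝ 2 f)
    (hcrit : fderiv ℝ f x₀ = 0) {ε : ℝ} (hε : 0 < ε) :
    ∃ r > 0, ∀ x ∈ closedBall x₀ r,
      |f x - f x₀ - fderiv ℝ (fderiv ℝ f) x₀ (x - x₀) (x - x₀) / 2| ≤ ε * ‖x - x₀‖ ^ 2 := by
  have hf1 : Differentiable ℝ f := hf.differentiable (by norm_num)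
  have hf2 : Differentiable ℝ (fderiv ℝ f) :=
    (hf.fderiv_right (m := 1) (by norm_num)).differentiable (by norm_num)
  have hlit := (hf2 x₀).hasFDerivAt.isLittleO.def hε
  obtain ⟨r, hr, hball⟩ := nhds_basis_closedBall.eventually_iff.1 hlit
  refine ⟨r, hr, fun x hx => ?_⟩
  set H := fderiv ℝ (fderiv ℝ f) x₀
  set h := x - x₀
  have hh : ‖h‖ ≤ r := by simpa [h, dist_eq_norm] using hx
  let k : ℝ → ℝ := fun t => f (x₀ + t • h) - t ^ 2 / 2 * H h h
  have hk : ∀ t, HasDerivAt k (fderiv ℝ f (x₀ + t • h) h - t * H h h) t := fun t => by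
    have h1 : HasDerivAt (fun t : ℝ => x₀ + t • h) h t := by
      simpa using ((hasDerivAt_id t).smul_const h).const_add x₀
    have h2 := (hf1 (x₀ + t • h)).hasFDerivAt.comp_hasDerivAt t h1
    have h3 : HasDerivAt (fun t : ℝ => t ^ 2 / 2 * H h h) (t * H h h) t := by
      have := (((hasDerivAt_id t).pow 2).div_const 2).mul_const (H h h)
      simpa using this
    exact h2.sub h3
  have hbound : ∀ t ∈ Set.Ico (0 : ℝ) 1,
      ‖fderiv ℝ f (x₀ + t • h) h - t * H h h‖ ≤ ε * ‖h‖ ^ 2 := fun t ht => by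
    have hmem : x₀ + t • h ∈ closedBall x₀ r := by
      rw [mem_closedBall, dist_eq_norm, add_sub_cancel_left, norm_smul, Real.norm_eq_abs,
        abs_of_nonneg ht.1]
      nlinarith [norm_nonneg h, ht.2, ht.1]
    have h1 := hball hmem
    rw [hcrit, sub_zero, add_sub_cancel_left] at h1
    have h2 := (fderiv ℝ f (x₀ + t • h) - H (t • h)).le_opNorm h
    have h3 : (fderiv ℝ f (x₀ + t • h) - H (t • h)) h = fderiv ℝ f (x₀ + t • h) h - t * H h h := by
      simp
    rw [h3] at h2
    refine h2.trans ?_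
    have h4 : ‖t • h‖ ≤ ‖h‖ := by
      rw [norm_smul, Real.norm_eq_abs, abs_of_nonneg ht.1]
      nlinarith [norm_nonneg h, ht.2]
    calc _ ≤ (ε * ‖t • h‖) * ‖h‖ := by gcongr
      _ ≤ (ε * ‖h‖) * ‖h‖ := by gcongr
      _ = _ := by ring
  have := norm_image_sub_le_of_norm_deriv_le_segment_01'
    (fun t _ => (hk t).hasDerivWithinAt) hbound
  have hx' : x₀ + h = x := by simp [h]
  rw [Real.norm_eq_abs] at this
  convert this using 2
  simp [k, hx']
  ring

/-- A positive definite bounded bilinear form on a finite-dimensional space is coercive. -/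
lemma exists_mul_sq_norm_le_of_posDef [FiniteDimensional ℝ E] (H : E →L[ℝ] E →L[ℝ] ℝ)
    (hH : ∀ v, v ≠ 0 → 0 < H v v) : ∃ c > 0, ∀ v, c * ‖v‖ ^ 2 ≤ H v v := by
  have hcont : Continuous fun v => H v v := by fun_prop
  have := FiniteDimensional.proper ℝ E
  rcases (sphere (0 : E) 1).eq_empty_or_nonempty with he | hne
  · refine ⟨1, one_pos, fun v => ?_⟩
    have hv : v = 0 := by
      by_contra hv
      have : ‖v‖⁻¹ • v ∈ sphere (0 : E) 1 := by
        simp [norm_smul, norm_ne_zero_iff.2 hv]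
      simp [he] at this
    simp [hv]
  · obtain ⟨w, hw, hmin⟩ := (isCompact_sphere (0 : E) 1).exists_isMinOn hne hcont.continuousOn
    have hw0 : w ≠ 0 := by
      rintro rfl
      simp at hw
    refine ⟨H w w, hH w hw0, fun v => ?_⟩
    rcases eq_or_ne v 0 with rfl | hv
    · simp
    have hv' : ‖v‖ ≠ 0 := norm_ne_zero_iff.2 hv
    have : ‖v‖⁻¹ • v ∈ sphere (0 : E) 1 := by simp [norm_smul, hv']
    have h1 : H w w ≤ H (‖v‖⁻¹ • v) (‖v‖⁻¹ • v) := hmin this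
    simp only [map_smul, _root_.smul_apply, smul_eq_mul] at h1
    calc H w w * ‖v‖ ^ 2 ≤ (‖v‖⁻¹ * (‖v‖⁻¹ * H v v)) * ‖v‖ ^ 2 := by gcongr
      _ = H v v := by field_simp

/-- Near a nondegenerate minimum a `C²` function is squeezed between two multiples of the squared
distance to the minimum. -/
lemma exists_quadratic_bounds [FiniteDimensional ℝ E] {f : E → ℝ} {x₀ : E} (hf : ContDiff ℝ 2 f)
    (hmin : ∀ x, f x₀ ≤ f x) (hpos : ∀ v, v ≠ 0 → 0 < iteratedFDeriv ℝ 2 f x₀ ![v, v]) :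
    ∃ r > 0, ∃ c > 0, ∃ K > 0, ∀ x ∈ closedBall x₀ r,
      c * ‖x - x₀‖ ^ 2 ≤ f x - f x₀ ∧ f x - f x₀ ≤ K * ‖x - x₀‖ ^ 2 := by
  have hcrit : fderiv ℝ f x₀ = 0 := IsLocalMin.fderiv_eq_zero (Eventually.of_forall hmin)
  set H := fderiv ℝ (fderiv ℝ f) x₀
  obtain ⟨c, hc, hcH⟩ := exists_mul_sq_norm_le_of_posDef H fun v hv => by
    simpa [iteratedFDeriv_two_apply] using hpos v hv
  obtain ⟨r, hr, hT⟩ := exists_abs_sub_half_hessian_le hf hcrit (show 0 < c / 4 by positivity)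
  refine ⟨r, hr, c / 4, by positivity, ‖H‖ / 2 + c / 4, by positivity, fun x hx => ?_⟩
  have h1 := abs_le.1 (hT x hx)
  have h2 := hcH (x - x₀)
  have h3 : H (x - x₀) (x - x₀) ≤ ‖H‖ * ‖x - x₀‖ ^ 2 := by
    have := (le_abs_self _).trans (H.le_opNorm₂ (x - x₀) (x - x₀))
    linarith
  constructor <;> nlinarith [h1.1, h1.2]

end Taylor

section Laplace

variable {E : Type*} [NormedAddCommGroup E] [InnerProductSpace ℝ E] [FiniteDimensional ℝ E]
  [MeasurableSpace E] [BorelSpace E] {U : E → ℝ} {s₀ : ℝ}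

lemma integrable_exp_neg_mul_of_le (hU : Continuous U) (hU0 : ∀ x, 0 ≤ U x)
    (hint : Integrable fun x => Real.exp (-(s₀ * U x))) {s : ℝ} (hs : s₀ ≤ s) :
    Integrable fun x => Real.exp (-(s * U x)) := by
  refine hint.mono' (by fun_prop) (ae_of_all _ fun x => ?_)
  rw [Real.norm_eq_abs, Real.abs_exp, Real.exp_le_exp]
  nlinarith [hU0 x]

lemma exists_rpow_le_integral_exp_neg_mul (hU : Continuous U) (hU0 : ∀ x, 0 ≤ U x)
    (hint : Integrable fun x => Real.exp (-(s₀ * U x))) (hs₀ : 0 < s₀)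
    {x₀ : E} {r K : ℝ} (hr : 0 < r) (hK : 0 < K)
    (hle : ∀ x ∈ closedBall x₀ r, U x ≤ K * ‖x - x₀‖ ^ 2) :
    ∃ c > 0, ∀ s, s₀ ≤ s →
      c * s ^ (-(Module.finrank ℝ E / 2 : ℝ)) ≤ ∫ x, Real.exp (-(s * U x)) := by
  set n := Module.finrank ℝ E
  have hvol : 0 < (volume : Measure E).real (ball 0 1) :=
    ENNReal.toReal_pos (measure_ball_pos _ _ one_pos).ne' measure_ball_lt_top.ne
  refine ⟨Real.exp (-(K * r ^ 2 * s₀)) * ((r * √s₀) ^ n * (volume : Measure E).real (ball 0 1)),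
    by positivity, fun s hs => ?_⟩
  have hspos : 0 < s := hs₀.trans_le hs
  set ρ := r * √s₀ / √s
  have hρ : 0 ≤ ρ := by positivity
  have hρr : ρ ≤ r := by
    rw [div_le_iff₀ (Real.sqrt_pos.2 hspos)]
    gcongr
  have hρsq : s * ρ ^ 2 = r ^ 2 * s₀ := by
    simp only [ρ]
    rw [div_pow, mul_pow, Real.sq_sqrt hs₀.le, Real.sq_sqrt hspos.le]
    field_simp
  have hints := integrable_exp_neg_mul_of_le hU hU0 hint hs
  have hpow : ρ ^ n = (r * √s₀) ^ n * s ^ (-(n / 2 : ℝ)) := by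
    simp only [ρ]
    rw [div_pow, Real.rpow_neg hspos.le, div_eq_mul_inv, Real.sqrt_eq_rpow s,
      ← Real.rpow_mul_natCast hspos.le]
    congr 3
    ring
  have hB : ∀ x ∈ closedBall x₀ ρ, Real.exp (-(K * r ^ 2 * s₀)) ≤ Real.exp (-(s * U x)) := by
    intro x hx
    have h1 := hle x (closedBall_subset_closedBall hρr hx)
    have h2 : ‖x - x₀‖ ≤ ρ := by simpa [dist_eq_norm] using hx
    rw [Real.exp_le_exp, neg_le_neg_iff]
    calc s * U x ≤ s * (K * ρ ^ 2) := by
          refine mul_le_mul_of_nonneg_left (h1.trans ?_) hspos.le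
          gcongr
      _ = K * (s * ρ ^ 2) := by ring
      _ = K * r ^ 2 * s₀ := by rw [hρsq]; ring
  calc _ = Real.exp (-(K * r ^ 2 * s₀)) * (volume : Measure E).real (closedBall x₀ ρ) := by
        rw [Measure.addHaar_real_closedBall _ _ hρ, hpow]
        ring
    _ = ∫ x in closedBall x₀ ρ, Real.exp (-(K * r ^ 2 * s₀)) := by
        rw [setIntegral_const, smul_eq_mul, mul_comm]
    _ ≤ ∫ x in closedBall x₀ ρ, Real.exp (-(s * U x)) :=
        setIntegral_mono_on (integrableOn_const measure_closedBall_lt_top.ne) hints.integrableOn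
          measurableSet_closedBall hB
    _ ≤ _ := setIntegral_le_integral hints (ae_of_all _ fun x => (Real.exp_pos _).le)

lemma integrable_exp_neg_mul_sq_norm_sub {b : ℝ} (hb : 0 < b) (y : E) :
    Integrable fun x : E => Real.exp (-b * ‖x - y‖ ^ 2) := by
  have h := (GaussianFourier.integrable_cexp_neg_mul_sq_norm_add (V := E) (b := (b : ℂ))
    (by simpa using hb) 0 0).norm
  have h' : Integrable fun x : E => Real.exp (-b * ‖x‖ ^ 2) := by
    refine h.congr (ae_of_all _ fun x => ?_)
    simp [Complex.norm_exp, ← Complex.ofReal_pow]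
  exact h'.comp_sub_right y

lemma rpow_mul_exp_neg_le {p δ s : ℝ} (hp : 0 < p) (hδ : 0 < δ) (hs : 0 < s) :
    Real.exp (-(s * δ)) ≤ (p / δ) ^ p * s ^ (-p) := by
  have h1 : (δ / p * s) ^ p ≤ Real.exp (s * δ) := by
    calc (δ / p * s) ^ p ≤ Real.exp (δ / p * s) ^ p := by
          gcongr
          linarith [Real.add_one_le_exp (δ / p * s)]
      _ = Real.exp (s * δ) := by
          rw [← Real.exp_mul]
          congr 1
          field_simp
  rw [Real.exp_neg]
  refine (inv_anti₀ (by positivity) h1).trans_eq ?_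
  rw [Real.mul_rpow (by positivity) hs.le, mul_inv, Real.rpow_neg hs.le,
    ← Real.inv_rpow (by positivity), inv_div]

lemma exists_integral_exp_neg_mul_le_rpow [Nontrivial E] (hU : Continuous U) (hU0 : ∀ x, 0 ≤ U x)
    (hint : Integrable fun x => Real.exp (-(s₀ * U x))) (hs₀ : 0 < s₀)
    {S : Finset E} {c δ : ℝ} (hc : 0 < c) (hδ : 0 < δ)
    (hle : ∀ x, (∃ y ∈ S, c * ‖x - y‖ ^ 2 ≤ U x) ∨ δ ≤ U x) :
    ∃ C > 0, ∀ s, s₀ ≤ s →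
      ∫ x, Real.exp (-(s * U x)) ≤ C * s ^ (-(Module.finrank ℝ E / 2 : ℝ)) := by
  have hn : 0 < Module.finrank ℝ E := Module.finrank_pos
  set p : ℝ := Module.finrank ℝ E / 2
  have hp : 0 < p := by positivity
  have hZ := integral_exp_pos hint
  refine ⟨S.card * (Real.pi / c) ^ p + (p / δ) ^ p * Real.exp (s₀ * δ) *
    ∫ x, Real.exp (-(s₀ * U x)), by positivity, fun s hs => ?_⟩
  have hspos : 0 < s := hs₀.trans_le hs
  have hpt : ∀ x, Real.exp (-(s * U x)) ≤ (∑ y ∈ S, Real.exp (-(s * c) * ‖x - y‖ ^ 2)) +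
      Real.exp (-(s * δ)) * Real.exp (s₀ * δ) * Real.exp (-(s₀ * U x)) := fun x => by
    rcases hle x with ⟨y, hy, hxy⟩ | hx
    · have h1 : Real.exp (-(s * U x)) ≤ Real.exp (-(s * c) * ‖x - y‖ ^ 2) := by
        rw [Real.exp_le_exp]
        nlinarith
      have h2 := Finset.single_le_sum (f := fun y => Real.exp (-(s * c) * ‖x - y‖ ^ 2))
        (fun y _ => (Real.exp_pos _).le) hy
      have h3 : 0 ≤ Real.exp (-(s * δ)) * Real.exp (s₀ * δ) * Real.exp (-(s₀ * U x)) := by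
        positivity
      linarith
    · have h1 : 0 ≤ ∑ y ∈ S, Real.exp (-(s * c) * ‖x - y‖ ^ 2) :=
        Finset.sum_nonneg fun y _ => (Real.exp_pos _).le
      have h2 : Real.exp (-(s * U x)) ≤
          Real.exp (-(s * δ)) * Real.exp (s₀ * δ) * Real.exp (-(s₀ * U x)) := by
        rw [← Real.exp_add, ← Real.exp_add, Real.exp_le_exp]
        nlinarith
      linarith
  have hg : ∀ y ∈ S, Integrable fun x : E => Real.exp (-(s * c) * ‖x - y‖ ^ 2) :=
    fun y _ => integrable_exp_neg_mul_sq_norm_sub (by positivity) y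
  have hgauss : ∀ y : E, ∫ x : E, Real.exp (-(s * c) * ‖x - y‖ ^ 2) =
      (Real.pi / c) ^ p * s ^ (-p) := fun y => by
    rw [integral_sub_right_eq_self (fun x : E => Real.exp (-(s * c) * ‖x‖ ^ 2)) y,
      GaussianFourier.integral_rexp_neg_mul_sq_norm (by positivity), Real.rpow_neg hspos.le,
      ← Real.inv_rpow hspos.le, ← Real.mul_rpow (by positivity) (by positivity)]
    congr 1
    field_simp
  calc ∫ x, Real.exp (-(s * U x))
      ≤ ∫ x, ((∑ y ∈ S, Real.exp (-(s * c) * ‖x - y‖ ^ 2)) +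
          Real.exp (-(s * δ)) * Real.exp (s₀ * δ) * Real.exp (-(s₀ * U x))) :=
        integral_mono (integrable_exp_neg_mul_of_le hU hU0 hint hs)
          ((integrable_finsetSum _ hg).add (hint.const_mul _)) hpt
    _ = S.card * ((Real.pi / c) ^ p * s ^ (-p)) +
          Real.exp (-(s * δ)) * Real.exp (s₀ * δ) * ∫ x, Real.exp (-(s₀ * U x)) := by
        rw [integral_add (integrable_finsetSum _ hg) (hint.const_mul _), integral_finsetSum _ hg,
          integral_const_mul, Finset.sum_congr rfl fun y _ => hgauss y, Finset.sum_const,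
          nsmul_eq_mul]
    _ ≤ S.card * ((Real.pi / c) ^ p * s ^ (-p)) +
          ((p / δ) ^ p * s ^ (-p)) * Real.exp (s₀ * δ) * ∫ x, Real.exp (-(s₀ * U x)) := by
        gcongr
        exact rpow_mul_exp_neg_le hp hδ hspos
    _ = _ := by ring

lemma integral_exp_sub_le (hU : Continuous U) (hU0 : ∀ x, 0 ≤ U x)
    (hint : Integrable fun x => Real.exp (-(s₀ * U x)))
    {θ s t : ℝ} (hθ1 : θ < 1) (hs : s₀ ≤ θ * s) (hspos : 0 < s) (hst : s ≤ t) :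
    (∫ x, Real.exp (-(s * U x))) - ∫ x, Real.exp (-(t * U x)) ≤
      (t - s) / s * (1 - θ)⁻¹ * ∫ x, Real.exp (-(θ * s * U x)) := by
  have hss : s₀ ≤ s := by nlinarith
  have hθ : 0 < 1 - θ := by linarith
  have his := integrable_exp_neg_mul_of_le hU hU0 hint hss
  have hit := integrable_exp_neg_mul_of_le hU hU0 hint (hss.trans hst)
  rw [← integral_sub his hit, ← integral_const_mul]
  refine integral_mono (his.sub hit)
    ((integrable_exp_neg_mul_of_le hU hU0 hint hs).const_mul _) fun x => ?_
  have hUx := hU0 x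
  have h1 : Real.exp (-(t * U x)) = Real.exp (-(s * U x)) * Real.exp (-((t - s) * U x)) := by
    rw [← Real.exp_add]; ring_nf
  have h2 := Real.add_one_le_exp (-((t - s) * U x))
  have h3 : Real.exp (-(s * U x)) =
      Real.exp (-(θ * s * U x)) * Real.exp (-((1 - θ) * s * U x)) := by
    rw [← Real.exp_add]; ring_nf
  have h4 : (1 - θ) * s * U x * Real.exp (-((1 - θ) * s * U x)) ≤ 1 := by
    rw [Real.exp_neg, ← div_eq_mul_inv, div_le_one (Real.exp_pos _)]
    linarith [Real.add_one_le_exp ((1 - θ) * s * U x)]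
  have hts : 0 ≤ t - s := by linarith
  calc Real.exp (-(s * U x)) - Real.exp (-(t * U x))
      = Real.exp (-(s * U x)) * (1 - Real.exp (-((t - s) * U x))) := by rw [h1]; ring
    _ ≤ Real.exp (-(s * U x)) * ((t - s) * U x) := by gcongr; linarith
    _ = (t - s) / s * (1 - θ)⁻¹ * Real.exp (-(θ * s * U x)) *
          ((1 - θ) * s * U x * Real.exp (-((1 - θ) * s * U x))) := by rw [h3]; field_simp
    _ ≤ (t - s) / s * (1 - θ)⁻¹ * Real.exp (-(θ * s * U x)) * 1 := by gcongr
    _ = _ := mul_one _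

/-- Relative decrease of the partition function `s ↦ ∫ exp (-s U)` when `U` has finitely many
nondegenerate zeros. -/
lemma exists_one_sub_integral_exp_div_le [Nontrivial E] (hU : Continuous U) (hU0 : ∀ x, 0 ≤ U x)
    (hint : Integrable fun x => Real.exp (-(s₀ * U x))) (hs₀ : 0 < s₀)
    {x₀ : E} {r K : ℝ} (hr : 0 < r) (hK : 0 < K)
    (hupper : ∀ x ∈ closedBall x₀ r, U x ≤ K * ‖x - x₀‖ ^ 2)
    {S : Finset E} {c δ : ℝ} (hc : 0 < c) (hδ : 0 < δ)
    (hlower : ∀ x, (∃ y ∈ S, c * ‖x - y‖ ^ 2 ≤ U x) ∨ δ ≤ U x)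
    {s₁ : ℝ} (hs₁ : s₀ < s₁) :
    ∃ M > 0, ∀ s t, s₁ ≤ s → s ≤ t →
      1 - (∫ x, Real.exp (-(t * U x))) / (∫ x, Real.exp (-(s * U x))) ≤ M * ((t - s) / s) := by
  obtain ⟨c₁, hc₁, hlow⟩ := exists_rpow_le_integral_exp_neg_mul hU hU0 hint hs₀ hr hK hupper
  obtain ⟨C₁, hC₁, hup⟩ := exists_integral_exp_neg_mul_le_rpow hU hU0 hint hs₀ hc hδ hlower
  set p : ℝ := Module.finrank ℝ E / 2
  have hs₁pos : 0 < s₁ := hs₀.trans hs₁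
  set θ := s₀ / s₁
  have hθ0 : 0 < θ := by positivity
  have hθ1 : θ < 1 := (div_lt_one hs₁pos).2 hs₁
  have hθ' : 0 < 1 - θ := by linarith
  refine ⟨(1 - θ)⁻¹ * (C₁ * θ ^ (-p) / c₁), by positivity, fun s t hs hst => ?_⟩
  have hspos : 0 < s := hs₁pos.trans_le hs
  have hθs : s₀ ≤ θ * s := by
    calc s₀ = θ * s₁ := by simp only [θ]; field_simp
      _ ≤ θ * s := by gcongr
  have hZ := integral_exp_pos (integrable_exp_neg_mul_of_le hU hU0 hint (hs₁.le.trans hs))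
  have h1 := integral_exp_sub_le hU hU0 hint hθ1 hθs hspos hst
  have h2 : ∫ x, Real.exp (-(θ * s * U x)) ≤
      C₁ * θ ^ (-p) / c₁ * ∫ x, Real.exp (-(s * U x)) := by
    calc _ ≤ C₁ * (θ * s) ^ (-p) := hup _ hθs
      _ = C₁ * θ ^ (-p) / c₁ * (c₁ * s ^ (-p)) := by
          rw [Real.mul_rpow hθ0.le hspos.le]; field_simp
      _ ≤ _ := by gcongr; exact hlow s (hs₁.le.trans hs)
  have hts : 0 ≤ t - s := by linarith
  rw [one_sub_div hZ.ne', div_le_iff₀ hZ]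
  calc _ ≤ _ := h1
    _ ≤ (t - s) / s * (1 - θ)⁻¹ * (C₁ * θ ^ (-p) / c₁ * ∫ x, Real.exp (-(s * U x))) := by gcongr
    _ = _ := by ring

end Laplace

/-- A coercive continuous function is bounded away from zero off any open neighbourhood of its
zeros. -/
lemma exists_pos_le_of_notMem {E : Type*} [TopologicalSpace E] {U : E → ℝ} (hU : Continuous U)
    (hcoer : Tendsto U (cocompact E) atTop) {N : Set E} (hN : IsOpen N)
    (hpos : ∀ x ∉ N, 0 < U x) : ∃ δ > 0, ∀ x ∉ N, δ ≤ U x := by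
  rcases Nᶜ.eq_empty_or_nonempty with he | ⟨x₀, hx₀⟩
  · exact ⟨1, one_pos, fun x hx => absurd (show x ∈ Nᶜ from hx) (by simp [he])⟩
  · obtain ⟨y, hy, hmin⟩ := hU.continuousOn.exists_isMinOn' hN.isClosed_compl hx₀
      ((hcoer.eventually_ge_atTop (U x₀)).filter_mono inf_le_left)
    exact ⟨U y, hpos y hy, fun x hx => hmin hx⟩

lemma integrable_of_integrable_sq_norm_mul {E : Type*} [NormedAddCommGroup E] [ProperSpace E]
    [MeasurableSpace E] [BorelSpace E] {μ : Measure E} [IsFiniteMeasureOnCompacts μ]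
    {f : E → ℝ} (hf : Continuous f) (hint : Integrable (fun x => ‖x‖ ^ 2 * f x) μ) :
    Integrable f μ := by
  rw [← integrableOn_univ, ← Set.union_compl_self (closedBall (0 : E) 1)]
  refine IntegrableOn.union (hf.continuousOn.integrableOn_compact (isCompact_closedBall _ _)) ?_
  refine Integrable.mono hint.integrableOn hf.aestronglyMeasurable ?_
  filter_upwards [ae_restrict_mem measurableSet_closedBall.compl] with x hx
  have hx' : 1 < ‖x‖ := by simpa using hx
  rw [norm_mul, norm_pow, norm_norm]
  exact le_mul_of_one_le_left (norm_nonneg _) (one_le_pow₀ hx'.le)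

lemma log_add_sub_log_add_le {C β x e : ℝ} (hC : 0 < C) (hβ : 0 < β) (hx : 0 < x) (he : 0 < e) :
    Real.log (C * (x + 1) ^ (1 + β) + e) - Real.log (C * x ^ (1 + β) + e) ≤ (1 + β) / x := by
  have hx1 : x ^ (1 + β) ≤ (x + 1) ^ (1 + β) := by gcongr; linarith
  have h0 : 0 < x ^ (1 + β) := by positivity
  rw [← Real.log_div (by positivity) (by positivity)]
  have h1 : (C * (x + 1) ^ (1 + β) + e) / (C * x ^ (1 + β) + e) ≤ (1 + 1 / x) ^ (1 + β) := by
    rw [show 1 + 1 / x = (x + 1) / x by field_simp, Real.div_rpow (by positivity) hx.le,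
      div_le_div_iff₀ (by positivity) h0]
    nlinarith
  calc _ ≤ Real.log ((1 + 1 / x) ^ (1 + β)) := Real.log_le_log (by positivity) h1
    _ = (1 + β) * Real.log (1 + 1 / x) := Real.log_rpow (by positivity) _
    _ ≤ (1 + β) * (1 / x) := by
        gcongr
        linarith [Real.log_le_sub_one_of_pos (show 0 < 1 + 1 / x by positivity)]
    _ = _ := by ring

lemma log_le_mul_log_add_exp_one {C β x : ℝ} (hC : 0 < C) (hβ : 0 < β) (hx : 1 ≤ x) :
    Real.log x ≤ (1 + |Real.log C|) * Real.log (C * x ^ (1 + β) + Real.exp 1) := by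
  have hx0 : 0 < x := by linarith
  have h0 : 0 < x ^ (1 + β) := by positivity
  have h1 : 1 ≤ Real.log (C * x ^ (1 + β) + Real.exp 1) := by
    rw [Real.le_log_iff_exp_le (by positivity)]
    have : 0 < C * x ^ (1 + β) := by positivity
    linarith
  have h2 : Real.log (C * x ^ (1 + β)) ≤ Real.log (C * x ^ (1 + β) + Real.exp 1) :=
    Real.log_le_log (by positivity) (by linarith [Real.exp_pos 1])
  rw [Real.log_mul hC.ne' h0.ne', Real.log_rpow hx0] at h2
  have h3 := Real.log_nonneg hx
  have h4 := neg_abs_le (Real.log C)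
  nlinarith [abs_nonneg (Real.log C), mul_nonneg hβ.le h3]

/-- With `T_n = C_T n^{1+β}` and `a_n = A/√(log(T_n+e))`, there is a constant `C > 0` such
that `d_TV(ν_{a_n}, ν_{a_{n+1}}) ≤ C/(n log n)` for all `n ≥ 2`. -/
theorem dTV_gibbs_consecutive (d : ℕ) (hd : 0 < d) (A CT β : ℝ) (hA : 0 < A) (hCT : 0 < CT)
    (hβ : 0 < β) (V : EuclideanSpace ℝ (Fin d) → ℝ) (Vstar : ℝ)
    (hV_pos : ∀ x, 0 < V x)
    (hV_C2 : ContDiff ℝ 2 V)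
    (hV_coercive : Tendsto V (cocompact (EuclideanSpace ℝ (Fin d))) atTop)
    (hV_int : Integrable (fun x => ‖x‖ ^ 2 * Real.exp (-2 * V x / A ^ 2)) volume)
    (hVstar_pos : 0 < Vstar)
    (hVstar_min : ∀ x, Vstar ≤ V x)
    (hargmin : ∃ S : Finset (EuclideanSpace ℝ (Fin d)), S.Nonempty ∧
      (∀ x, V x = Vstar ↔ x ∈ S) ∧
      ∀ x ∈ S, ∀ v : EuclideanSpace ℝ (Fin d), v ≠ 0 →
        0 < iteratedFDeriv ℝ 2 V x ![v, v]) :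
    ∃ C : ℝ, 0 < C ∧ ∀ n : ℕ, 2 ≤ n →
      dTV (gibbs V Vstar (A / Real.sqrt (Real.log (CT * (n : ℝ) ^ (1 + β) + Real.exp 1))))
          (gibbs V Vstar (A / Real.sqrt (Real.log (CT * ((n : ℝ) + 1) ^ (1 + β) + Real.exp 1))))
        ≤ C / ((n : ℝ) * Real.log (n : ℝ)) := by
  obtain ⟨S, ⟨x₀, hx₀⟩, hS, hH⟩ := hargmin
  have : Nonempty (Fin d) := ⟨⟨0, hd⟩⟩
  set U : EuclideanSpace ℝ (Fin d) → ℝ := fun x => V x - Vstar with hUdef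
  have hVc : Continuous V := hV_C2.continuous
  have hU : Continuous U := hVc.sub continuous_const
  have hU0 : ∀ x, 0 ≤ U x := fun x => sub_nonneg.2 (hVstar_min x)
  have hquad : ∀ y ∈ S, ∃ r > 0, ∃ c > 0, ∃ K > 0, ∀ x ∈ closedBall y r,
      c * ‖x - y‖ ^ 2 ≤ U x ∧ U x ≤ K * ‖x - y‖ ^ 2 := fun y hy => by
    have hy' : V y = Vstar := (hS y).2 hy
    simpa only [hy'] using
      exists_quadratic_bounds hV_C2 (fun x => hy'.trans_le (hVstar_min x)) (hH y hy)
  obtain ⟨r₀, hr₀, _, _, K, hK, hupper⟩ := hquad x₀ hx₀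
  choose! r hr c hc _ _ hlow using hquad
  have hSne : S.Nonempty := ⟨x₀, hx₀⟩
  obtain ⟨y₀, hy₀, hy₀min⟩ := S.exists_min_image c hSne
  have hNopen : IsOpen (⋃ y ∈ S, ball y (r y)) := isOpen_biUnion fun y _ => isOpen_ball
  obtain ⟨δ, hδ, hδU⟩ := exists_pos_le_of_notMem hU
    (tendsto_atTop_add_const_right _ (-Vstar) hV_coercive) hNopen fun x hx => by
      refine (hU0 x).lt_of_ne fun h => hx ?_
      have hxS : x ∈ S := (hS x).1 (by simp only [hUdef] at h; linarith)
      exact Set.mem_biUnion hxS (mem_ball_self (hr x hxS))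
  have hlower : ∀ x, (∃ y ∈ S, c y₀ * ‖x - y‖ ^ 2 ≤ U x) ∨ δ ≤ U x := fun x => by
    by_cases hx : x ∈ ⋃ y ∈ S, ball y (r y)
    · simp only [Set.mem_iUnion, exists_prop] at hx
      obtain ⟨y, hy, hxy⟩ := hx
      refine Or.inl ⟨y, hy, le_trans ?_ (hlow y hy x (ball_subset_closedBall hxy)).1⟩
      gcongr
      exact hy₀min y hy
    · exact Or.inr (hδU x hx)
  have hA2 : 0 < 2 / A ^ 2 := by positivity
  have hint : Integrable fun x => Real.exp (-(2 / A ^ 2 * U x)) := by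
    have h1 : Integrable fun x => Real.exp (-2 * V x / A ^ 2) :=
      integrable_of_integrable_sq_norm_mul (by fun_prop) hV_int
    refine (h1.const_mul (Real.exp (2 * Vstar / A ^ 2))).congr (ae_of_all _ fun x => ?_)
    simp only [hUdef]
    rw [← Real.exp_add]
    congr 1
    ring
  set L : ℝ → ℝ := fun x => Real.log (CT * x ^ (1 + β) + Real.exp 1) with hL
  have hL1 : 1 < L 1 := by
    simp only [hL]
    rw [Real.lt_log_iff_exp_lt (by positivity)]
    simp [hCT]
  have hLmono : ∀ x y, 0 < x → x ≤ y → L x ≤ L y := fun x y hx hxy => by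
    have : 0 < x ^ (1 + β) := by positivity
    exact Real.log_le_log (by positivity) (by gcongr)
  have hs₁ : 2 / A ^ 2 < 2 / A ^ 2 * L 1 := by nlinarith
  obtain ⟨M, hM, hMbound⟩ := exists_one_sub_integral_exp_div_le hU hU0 hint hA2 hr₀ hK
    (fun x hx => (hupper x hx).2) (hc y₀ hy₀) hδ hlower hs₁
  refine ⟨2 * M * ((1 + β) * (1 + |Real.log CT|)), by positivity, fun n hn => ?_⟩
  have hn1 : (1 : ℝ) < n := by exact_mod_cast hn
  have hn0 : (0 : ℝ) < n := by linarith
  have hLn : L 1 ≤ L n := hLmono 1 n one_pos hn1.le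
  have hLn' : L n ≤ L (n + 1) := hLmono n (n + 1) hn0 (by linarith)
  have hexp : ∀ ℓ : ℝ, 1 < ℓ → ∀ x, -2 * (V x - Vstar) / (A / √ℓ) ^ 2 = -(2 / A ^ 2 * ℓ * U x) :=
    fun ℓ hℓ x => by
      rw [div_pow, Real.sq_sqrt (by linarith)]
      simp only [hUdef]
      field_simp
  have e1 := hexp (L n) (by linarith)
  have e2 := hexp (L (n + 1)) (by linarith)
  have i1 := integrable_exp_neg_mul_of_le hU hU0 hint
    (show 2 / A ^ 2 ≤ 2 / A ^ 2 * L n by nlinarith)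
  have i2 := integrable_exp_neg_mul_of_le hU hU0 hint
    (show 2 / A ^ 2 ≤ 2 / A ^ 2 * L (n + 1) by nlinarith)
  have hst : 2 / A ^ 2 * L n ≤ 2 / A ^ 2 * L (n + 1) := by gcongr
  have hTV := dTV_gibbs_le (V := V) (Vstar := Vstar) (a := A / √(L n)) (b := A / √(L (n + 1)))
    (by simpa only [e1] using i1) (by simpa only [e2] using i2) fun x => by
      rw [e1, e2, neg_le_neg_iff]
      exact mul_le_mul_of_nonneg_right hst (hU0 x)
  simp only [e1, e2] at hTV
  have hlogn : 0 < Real.log n := Real.log_pos hn1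
  have hLpos : 0 < L n := by linarith
  have hdiff : L (n + 1) - L n ≤ (1 + β) / n :=
    log_add_sub_log_add_le hCT hβ hn0 (Real.exp_pos 1)
  have hlogle : Real.log n ≤ (1 + |Real.log CT|) * L n :=
    log_le_mul_log_add_exp_one hCT hβ hn1.le
  calc _ ≤ _ := hTV
    _ ≤ 2 * (M * ((2 / A ^ 2 * L (n + 1) - 2 / A ^ 2 * L n) / (2 / A ^ 2 * L n))) := by
        gcongr
        exact hMbound _ _ (by gcongr) hst
    _ = 2 * M * ((L (n + 1) - L n) / L n) := by
        rw [← mul_sub, mul_div_mul_left _ _ hA2.ne']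
        ring
    _ ≤ 2 * M * (((1 + β) / n) * ((1 + |Real.log CT|) / Real.log n)) := by
        gcongr
        rw [div_eq_mul_inv]
        gcongr
        rw [inv_eq_one_div, div_le_div_iff₀ hLpos hlogn]
        linarith
    _ = _ := by field_simp
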